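/- arXiv:1601.04864 — 7 statements merged into one kernel-verified Lean document; each statement's English description precedes it below -/
import Mathlib

section
/- For every linear map M : Matrix (Fin d₀) (Fin d₀) ℂ → Matrix (Fin d₁) (Fin d₁) ℂ there exist a finite family of matrices A_i, B_i ∈ Matrix (Fin d₁) (Fin d₀) ℂ and real numbers λ_i, μ_i such that M(X) = Σ_i A_i X B_i† for every X ∈ Matrix (Fin d₀) (Fin d₀) ℂ, with the orthogonality relations Tr[A_i† A_j] = λ_i δ_{ij} and Tr[B_i† B_j] = μ_i δ_{ij} for all i, j. -/
open Matrix

/-- Operator-sum representation with mutually orthogonal Kraus families,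
obtained from the singular value decomposition of the Choi matrix. -/
theorem operator_sum_representation (d₀ d₁ : ℕ)
    (M : Matrix (Fin d₀) (Fin d₀) ℂ →ₗ[ℂ] Matrix (Fin d₁) (Fin d₁) ℂ) :
    ∃ (k : ℕ) (A B : Fin k → Matrix (Fin d₁) (Fin d₀) ℂ) (lam mu : Fin k → ℝ),
      (∀ X : Matrix (Fin d₀) (Fin d₀) ℂ, M X = ∑ i, A i * X * (B i)ᴴ) ∧
      (∀ i j, ((A i)ᴴ * A j).trace = if i = j then (lam i : ℂ) else 0) ∧
      (∀ i j, ((B i)ᴴ * B j).trace = if i = j then (mu i : ℂ) else 0) := by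
  classical
  let C : Matrix (Fin d₁ × Fin d₀) (Fin d₁ × Fin d₀) ℂ :=
    fun p q => M (Matrix.single p.2 q.2 1) p.1 q.1
  have hH : (Cᴴ * C).IsHermitian := isHermitian_conjTranspose_mul_self C
  obtain ⟨V, D, hV1, hV2, hD⟩ : ∃ (V : Matrix (Fin d₁ × Fin d₀) (Fin d₁ × Fin d₀) ℂ)
      (D : Fin d₁ × Fin d₀ → ℝ), Vᴴ * V = 1 ∧ V * Vᴴ = 1 ∧
      Vᴴ * (Cᴴ * C) * V = diagonal (fun i => (D i : ℂ)) := by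
    have h1 : hH.eigenvectorUnitary.1ᴴ * hH.eigenvectorUnitary.1 = 1 :=
      Unitary.coe_star_mul_self hH.eigenvectorUnitary
    have h2 : hH.eigenvectorUnitary.1 * hH.eigenvectorUnitary.1ᴴ = 1 :=
      Unitary.coe_mul_star_self hH.eigenvectorUnitary
    refine ⟨hH.eigenvectorUnitary.1, hH.eigenvalues, h1, h2, ?_⟩
    have h3 := hH.conjStarAlgAut_star_eigenvectorUnitary
    rw [Unitary.conjStarAlgAut_apply] at h3
    simpa [Matrix.star_eq_conjTranspose, Function.comp_def] using h3
  have hW : (C * V)ᴴ * (C * V) = diagonal (fun i => (D i : ℂ)) := by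
    rw [← hD, conjTranspose_mul]; simp only [Matrix.mul_assoc]
  have hC : (C * V) * Vᴴ = C := by rw [Matrix.mul_assoc, hV2, Matrix.mul_one]
  generalize C * V = W at hW hC
  have key : ∀ (U : Matrix (Fin d₁ × Fin d₀) (Fin d₁ × Fin d₀) ℂ) (a b : Fin d₁ × Fin d₀),
      ((Matrix.of fun i m => U (i, m) a)ᴴ * (Matrix.of fun i m => U (i, m) b)).trace
        = (Uᴴ * U) a b := by
    intro U a b
    simp only [Matrix.trace, Matrix.diag, Matrix.mul_apply, conjTranspose_apply, Matrix.of_apply,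
      Fintype.sum_prod_type]
    exact Finset.sum_comm
  let e := (Fintype.equivFin (Fin d₁ × Fin d₀)).symm
  refine ⟨Fintype.card (Fin d₁ × Fin d₀), fun k => Matrix.of fun i m => W (i, m) (e k),
    fun k => Matrix.of fun i m => V (i, m) (e k), fun k => D (e k), fun _ => 1, ?_, ?_, ?_⟩
  · intro X
    rw [Equiv.sum_comp e (fun k => (Matrix.of fun i m => W (i, m) k) * X *
      (Matrix.of fun i m => V (i, m) k)ᴴ)]
    ext i j
    have hX : M X = ∑ m, ∑ n, X m n • M (Matrix.single m n 1) := by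
      conv_lhs => rw [matrix_eq_sum_single X]
      simp only [map_sum]
      refine Finset.sum_congr rfl fun m _ => Finset.sum_congr rfl fun n _ => ?_
      rw [← map_smul, Matrix.smul_single, smul_eq_mul, mul_one]
    have hc : ∀ m n, M (Matrix.single m n 1) i j = ∑ k, W (i, m) k * star (V (j, n) k) := by
      intro m n
      have := congrFun (congrFun hC (i, m)) (j, n)
      rw [Matrix.mul_apply] at this
      exact this.symm
    rw [hX]
    simp only [Matrix.sum_apply, Matrix.smul_apply, hc, Matrix.mul_apply, conjTranspose_apply,
      Matrix.of_apply, smul_eq_mul, Finset.mul_sum, Finset.sum_mul]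
    rw [Finset.sum_comm]
    have hL : ∀ n, (∑ m, ∑ k, X m n * (W (i, m) k * star (V (j, n) k)))
        = ∑ k, ∑ m, W (i, m) k * X m n * star (V (j, n) k) := by
      intro n
      rw [Finset.sum_comm]
      refine Finset.sum_congr rfl fun k _ => Finset.sum_congr rfl fun m _ => ?_
      ring
    simp only [hL]
    exact Finset.sum_comm
  · intro a b
    rw [key, hW, diagonal_apply]
    simp only [e.injective.eq_iff]
  · intro a b
    rw [key, hV1, Matrix.one_apply]
    simp only [e.injective.eq_iff, Complex.ofReal_one]
end

section
/- Let M be a matrix on ℂ^{A} ⊗ ℂ^{B} (indexed by Fin a × Fin b) and N a matrix on ℂ^{B} ⊗ ℂ^{C} (indexed by Fin b × Fin c), and define their link product N*M := Tr_B[(M^{T_B} ⊗ I_C)(I_A ⊗ N)], a matrix on ℂ^{A} ⊗ ℂ^{C}. Then: (i) if M and N are Hermitian, N*M is Hermitian; (ii) if M and N are positive semidefinite, N*M is positive semidefinite. -/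
open Matrix
open scoped ComplexOrder

/-- The link product `N*M := Tr_B[(M^{T_B} ⊗ I_C)(I_A ⊗ N)]` of
`M` on `ℂ^A ⊗ ℂ^B` and `N` on `ℂ^B ⊗ ℂ^C`, a matrix on `ℂ^A ⊗ ℂ^C`;
all factors are regarded as matrices on `ℂ^A ⊗ ℂ^B ⊗ ℂ^C`. -/
noncomputable def linkProd {a b c : ℕ}
    (N : Matrix (Fin b × Fin c) (Fin b × Fin c) ℂ)
    (M : Matrix (Fin a × Fin b) (Fin a × Fin b) ℂ) :
    Matrix (Fin a × Fin c) (Fin a × Fin c) ℂ :=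
  Matrix.of fun p q => ∑ β : Fin b,
    ((Matrix.of fun r s : Fin a × Fin b × Fin c =>
        M (r.1, s.2.1) (s.1, r.2.1) * (if r.2.2 = s.2.2 then (1 : ℂ) else 0)) *
      (Matrix.of fun r s : Fin a × Fin b × Fin c =>
        (if r.1 = s.1 then (1 : ℂ) else 0) * N (r.2.1, r.2.2) (s.2.1, s.2.2)))
      (p.1, β, p.2) (q.1, β, q.2)

theorem linkProd_entry {a b c : ℕ}
    (M : Matrix (Fin a × Fin b) (Fin a × Fin b) ℂ)
    (N : Matrix (Fin b × Fin c) (Fin b × Fin c) ℂ) (p q : Fin a × Fin c) :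
    linkProd N M p q =
      ∑ β : Fin b, ∑ β' : Fin b, M (p.1, β') (q.1, β) * N (β', p.2) (β, q.2) := by
  simp only [linkProd, Matrix.of_apply, Matrix.mul_apply, Fintype.sum_prod_type]
  refine Finset.sum_congr rfl fun β _ => ?_
  rw [Finset.sum_eq_single q.1]
  · refine Finset.sum_congr rfl fun β' _ => ?_
    rw [Finset.sum_eq_single p.2]
    · simp
    · intro x _ hx
      simp [Ne.symm hx]
    · simp
  · intro x _ hx
    simp [hx]
  · simp

theorem linkProd_eq_conj {a b c : ℕ}
    (M : Matrix (Fin a × Fin b) (Fin a × Fin b) ℂ)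
    (N : Matrix (Fin b × Fin c) (Fin b × Fin c) ℂ) :
    ∃ V : Matrix ((Fin a × Fin c) × Fin b) (Fin a × Fin c) ℂ,
      linkProd N M = Vᴴ * ((Matrix.kroneckerMap (· * ·) M N).submatrix
        (fun r : (Fin a × Fin c) × Fin b => ((r.1.1, r.2), (r.2, r.1.2)))
        (fun r : (Fin a × Fin c) × Fin b => ((r.1.1, r.2), (r.2, r.1.2)))) * V := by
  refine ⟨Matrix.of fun r q => if r.1 = q then 1 else 0, ?_⟩
  ext p q
  rw [linkProd_entry]
  simp only [Matrix.mul_apply, Fintype.sum_prod_type (α₁ := Fin a × Fin c),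
    Matrix.conjTranspose_apply, Matrix.of_apply, Matrix.submatrix_apply,
    Matrix.kroneckerMap_apply]
  symm
  rw [Finset.sum_eq_single q]
  · refine Finset.sum_congr rfl fun β _ => ?_
    rw [Finset.sum_eq_single p]
    · simp
    · intro x _ hx
      simp [hx]
    · simp
  · intro x _ hx
    simp [hx]
  · simp

/-- The link product of Hermitian matrices is Hermitian, and the link product
of positive semidefinite matrices is positive semidefinite. -/
theorem linkProd_isHermitian_and_posSemidef {a b c : ℕ}
    (M : Matrix (Fin a × Fin b) (Fin a × Fin b) ℂ)
    (N : Matrix (Fin b × Fin c) (Fin b × Fin c) ℂ) :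
    (M.IsHermitian → N.IsHermitian → (linkProd N M).IsHermitian) ∧
    (M.PosSemidef → N.PosSemidef → (linkProd N M).PosSemidef) := by
  obtain ⟨V, hV⟩ := linkProd_eq_conj M N
  constructor
  · intro hM hN
    ext p q
    rw [Matrix.conjTranspose_apply, linkProd_entry, linkProd_entry, star_sum, Finset.sum_comm]
    simp only [star_sum]
    rw [Finset.sum_comm]
    rw [Finset.sum_comm]
    refine Finset.sum_congr rfl fun β _ => Finset.sum_congr rfl fun β' _ => ?_
    rw [star_mul', hM.apply, hN.apply]
  · intro hM hN
    rw [hV]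
    exact ((hM.kronecker hN).submatrix _).conjTranspose_mul_mul_same V
end

section
/- (Normalization of deterministic two-step quantum networks) Let C₁ be the Choi matrix of a quantum channel from Matrix (Fin d₀) ℂ to Matrix (Fin d₁ × Fin a) ℂ (so C₁ is a positive semidefinite matrix on ℂ^{d₁} ⊗ ℂ^{a} ⊗ ℂ^{d₀} whose partial trace over the d₁ and a factors is I_{d₀}), and let C₂ be the Choi matrix of a quantum channel from Matrix (Fin a × Fin d₂) ℂ to Matrix (Fin d₃) ℂ (positive semidefinite on ℂ^{d₃} ⊗ ℂ^{a} ⊗ ℂ^{d₂} with partial trace over the d₃ factor equal to I on ℂ^{a} ⊗ ℂ^{d₂}). Let R := C₂ * C₁ = Tr_a[(C₁^{T_a} ⊗ I)(I ⊗ C₂)] be their link product over the ancilla factor a, with identity factors and tensor ordering arranged so that R is a matrix on ℂ^{d₃} ⊗ ℂ^{d₂} ⊗ ℂ^{d₁} ⊗ ℂ^{d₀}. Then R is positive semidefinite and satisfies Tr₃[R] = I_{d₂} ⊗ R¹, where R¹ := Tr_a[C₁] is a matrix on ℂ^{d₁} ⊗ ℂ^{d₀} satisfying Tr₁[R¹]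 = I_{d₀}. -/
open Matrix
open scoped ComplexOrder

/-- Partial trace over the first factor of a tensor product. -/
noncomputable def ptrFst {A B : Type*} [Fintype A]
    (Y : Matrix (A × B) (A × B) ℂ) : Matrix B B ℂ :=
  Matrix.of fun b b' => ∑ x : A, Y (x, b) (x, b')

/-- Partial trace over the first two factors of a triple tensor product. -/
noncomputable def ptrFstSnd {A B C : Type*} [Fintype A] [Fintype B]
    (Y : Matrix (A × B × C) (A × B × C) ℂ) : Matrix C C ℂ :=
  Matrix.of fun c c' => ∑ x : A, ∑ y : B, Y (x, y, c) (x, y, c')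

/-- Partial trace over the middle factor of a triple tensor product. -/
noncomputable def ptrMid {A B C : Type*} [Fintype B]
    (Y : Matrix (A × B × C) (A × B × C) ℂ) : Matrix (A × C) (A × C) ℂ :=
  Matrix.of fun p q => ∑ y : B, Y (p.1, y, p.2) (q.1, y, q.2)

/-- `C₁^{T_a} ⊗ I_{d₃ d₂}`, regarded as a matrix on
`ℂ^{d₃} ⊗ ℂ^{d₂} ⊗ ℂ^{d₁} ⊗ ℂ^{a} ⊗ ℂ^{d₀}` (partial transpose over the
ancilla factor `a`). -/
noncomputable def fac₁ (d₃ d₂ : ℕ) {d₁ a d₀ : ℕ}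
    (C₁ : Matrix (Fin d₁ × Fin a × Fin d₀) (Fin d₁ × Fin a × Fin d₀) ℂ) :
    Matrix (Fin d₃ × Fin d₂ × Fin d₁ × Fin a × Fin d₀)
      (Fin d₃ × Fin d₂ × Fin d₁ × Fin a × Fin d₀) ℂ :=
  Matrix.of fun r s =>
    (if r.1 = s.1 then (1 : ℂ) else 0) * (if r.2.1 = s.2.1 then (1 : ℂ) else 0) *
      C₁ (r.2.2.1, s.2.2.2.1, r.2.2.2.2) (s.2.2.1, r.2.2.2.1, s.2.2.2.2)

/-- `I_{d₁ d₀} ⊗ C₂`, regarded as a matrix on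
`ℂ^{d₃} ⊗ ℂ^{d₂} ⊗ ℂ^{d₁} ⊗ ℂ^{a} ⊗ ℂ^{d₀}`. -/
noncomputable def fac₂ (d₁ d₀ : ℕ) {d₃ a d₂ : ℕ}
    (C₂ : Matrix (Fin d₃ × Fin a × Fin d₂) (Fin d₃ × Fin a × Fin d₂) ℂ) :
    Matrix (Fin d₃ × Fin d₂ × Fin d₁ × Fin a × Fin d₀)
      (Fin d₃ × Fin d₂ × Fin d₁ × Fin a × Fin d₀) ℂ :=
  Matrix.of fun r s =>
    (if r.2.2.1 = s.2.2.1 then (1 : ℂ) else 0) *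
      (if r.2.2.2.2 = s.2.2.2.2 then (1 : ℂ) else 0) *
      C₂ (r.1, r.2.2.2.1, r.2.1) (s.1, s.2.2.2.1, s.2.1)

/-- The link product `R := C₂ * C₁ = Tr_a[(C₁^{T_a} ⊗ I)(I ⊗ C₂)]` over the
ancilla factor `a`, a matrix on `ℂ^{d₃} ⊗ ℂ^{d₂} ⊗ ℂ^{d₁} ⊗ ℂ^{d₀}`. -/
noncomputable def link2 {d₁ a d₀ d₃ d₂ : ℕ}
    (C₁ : Matrix (Fin d₁ × Fin a × Fin d₀) (Fin d₁ × Fin a × Fin d₀) ℂ)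
    (C₂ : Matrix (Fin d₃ × Fin a × Fin d₂) (Fin d₃ × Fin a × Fin d₂) ℂ) :
    Matrix (Fin d₃ × Fin d₂ × Fin d₁ × Fin d₀)
      (Fin d₃ × Fin d₂ × Fin d₁ × Fin d₀) ℂ :=
  Matrix.of fun p q => ∑ β : Fin a,
    (fac₁ d₃ d₂ C₁ * fac₂ d₁ d₀ C₂)
      (p.1, p.2.1, p.2.2.1, β, p.2.2.2) (q.1, q.2.1, q.2.2.1, β, q.2.2.2)

lemma link2_apply {d₁ a d₀ d₃ d₂ : ℕ}
    (C₁ : Matrix (Fin d₁ × Fin a × Fin d₀) (Fin d₁ × Fin a × Fin d₀) ℂ)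
    (C₂ : Matrix (Fin d₃ × Fin a × Fin d₂) (Fin d₃ × Fin a × Fin d₂) ℂ)
    (p q : Fin d₃ × Fin d₂ × Fin d₁ × Fin d₀) :
    link2 C₁ C₂ p q = ∑ β : Fin a, ∑ α : Fin a,
      C₁ (p.2.2.1, α, p.2.2.2) (q.2.2.1, β, q.2.2.2) *
      C₂ (p.1, α, p.2.1) (q.1, β, q.2.1) := by
  simp only [link2, fac₁, fac₂, Matrix.of_apply, Matrix.mul_apply, Fintype.sum_prod_type]
  refine Finset.sum_congr rfl fun β _ => ?_
  rw [Finset.sum_eq_single p.1 (by intro b _ hb; simp [hb.symm]) (by simp),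
    Finset.sum_eq_single p.2.1 (by intro b _ hb; simp [hb.symm]) (by simp),
    Finset.sum_eq_single q.2.2.1 (by intro b _ hb; simp [hb]) (by simp)]
  refine Finset.sum_congr rfl fun α _ => ?_
  rw [Finset.sum_eq_single q.2.2.2 (by intro b _ hb; simp [hb]) (by simp)]
  simp

lemma link2_posSemidef {d₁ a d₀ d₃ d₂ : ℕ}
    (C₁ : Matrix (Fin d₁ × Fin a × Fin d₀) (Fin d₁ × Fin a × Fin d₀) ℂ)
    (C₂ : Matrix (Fin d₃ × Fin a × Fin d₂) (Fin d₃ × Fin a × Fin d₂) ℂ)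
    (h₁ : C₁.PosSemidef) (h₂ : C₂.PosSemidef) : (link2 C₁ C₂).PosSemidef := by
  have hK := (h₁.kronecker h₂).submatrix
    (fun r : (Fin d₃ × Fin d₂ × Fin d₁ × Fin d₀) × Fin a =>
      ((r.1.2.2.1, r.2, r.1.2.2.2), (r.1.1, r.2, r.1.2.1)))
  have hW := hK.conjTranspose_mul_mul_same
    (Matrix.of fun (r : (Fin d₃ × Fin d₂ × Fin d₁ × Fin d₀) × Fin a)
      (q : Fin d₃ × Fin d₂ × Fin d₁ × Fin d₀) => if r.1 = q then (1 : ℂ) else 0)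
  refine Eq.mp (congrArg Matrix.PosSemidef (Eq.symm ?_)) hW
  ext p q
  rw [link2_apply, Matrix.mul_apply, Fintype.sum_prod_type,
    Finset.sum_eq_single q (by intro b _ hb; simp [hb]) (by simp)]
  refine Finset.sum_congr rfl fun β _ => ?_
  rw [Matrix.mul_apply, Fintype.sum_prod_type,
    Finset.sum_eq_single p (by intro b _ hb; simp [hb]) (by simp)]
  simp [Matrix.kroneckerMap_apply]

/-- Normalization of deterministic two-step quantum networks: the link product
of the Choi matrices of two channels over the ancilla is positive semidefinite
and satisfies the recursive comb normalization `Tr₃[R] = I_{d₂} ⊗ R¹`,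
`Tr₁[R¹] = I_{d₀}` with `R¹ = Tr_a[C₁]`. -/
theorem two_step_network_normalization (d₀ d₁ d₂ d₃ a : ℕ)
    (C₁ : Matrix (Fin d₁ × Fin a × Fin d₀) (Fin d₁ × Fin a × Fin d₀) ℂ)
    (C₂ : Matrix (Fin d₃ × Fin a × Fin d₂) (Fin d₃ × Fin a × Fin d₂) ℂ)
    (h₁pos : C₁.PosSemidef) (h₁tp : ptrFstSnd C₁ = 1)
    (h₂pos : C₂.PosSemidef) (h₂tp : ptrFst C₂ = 1) :
    (link2 C₁ C₂).PosSemidef ∧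
    ptrFst (link2 C₁ C₂) =
      Matrix.of (fun p q => (if p.1 = q.1 then (1 : ℂ) else 0) *
        ptrMid C₁ (p.2.1, p.2.2) (q.2.1, q.2.2)) ∧
    ptrFst (ptrMid C₁) = 1 := by
  refine ⟨link2_posSemidef C₁ C₂ h₁pos h₂pos, ?_, ?_⟩
  · ext p q
    have h : ∀ α β : Fin a, ∑ x : Fin d₃, C₂ (x, α, p.1) (x, β, q.1) =
        if α = β ∧ p.1 = q.1 then 1 else 0 := by
      intro α β
      have := congrFun (congrFun h₂tp (α, p.1)) (β, q.1)
      simpa [ptrFst, Matrix.one_apply] using this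
    simp only [ptrFst, ptrMid, Matrix.of_apply, link2_apply]
    rw [Finset.sum_comm, Finset.mul_sum]
    refine Finset.sum_congr rfl fun β _ => ?_
    rw [Finset.sum_comm]
    simp only [← Finset.mul_sum, h]
    rw [Finset.sum_eq_single β (by intro b _ hb; simp [hb]) (by simp)]
    simp
  · rw [← h₁tp]
    ext p q
    simp [ptrFst, ptrMid, ptrFstSnd]
end

section
/- (No-cloning theorem for quantum channels) Let C₁ and C₂ be Choi matrices of quantum channels from Matrix (Fin d₀) ℂ to Matrix (Fin d₁) ℂ, with corresponding channels M₁, M₂. Let p be the single-use minimum worst-case discrimination error: the infimum, over all ancilla dimensions n, density matrices ρ on ℂ^{d₀} ⊗ ℂ^{n}, and two-outcome POVMs (P₁, P₂) on ℂ^{d₁} ⊗ ℂ^{n}, of max( Tr[((M₁ ⊗ id_n)(ρ)) P₂], Tr[((M₂ ⊗ id_n)(ρ)) P₁] ). Suppose the pair can be perfectly cloned with a single use: there exists a positive semidefinite matrix R on ℂ^{d₁} ⊗ ℂ^{d₁} ⊗ ℂ^{d₁} ⊗ ℂ^{d₀} ⊗ ℂ^{d₀} ⊗ ℂ^{d₀}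 (factors: the two clone outputs, the slot output, the slot input, and the two clone inputs) satisfying the two-comb normalization — the partial trace of R over the two clone-output factors equals I on the slot-output factor tensored with some R¹, and the partial trace of R¹ over the slot-input factor equals I on the two clone-input factors — such that for both k = 1, 2 the link product of R with C_k over the slot factors equals the Choi matrix of the product channel M_k ⊗ M_k. Then p = 0 or p = 1/2. -/
open Matrix
open scoped ComplexOrder

/-- The action of the channel with Choi matrix `C`, tensored with the identity
on `Fin n`: `((M ⊗ id_n)(ρ))_{(i,r),(j,s)} = Σ_{m,m'} ρ_{(m,r),(m',s)} C_{(i,m),(j,m')}`,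
i.e. `M(X) = Tr_in[(I ⊗ Xᵀ) C]` extended to an ancilla. -/
noncomputable def applyTens {d₀ d₁ : ℕ}
    (C : Matrix (Fin d₁ × Fin d₀) (Fin d₁ × Fin d₀) ℂ) {n : ℕ}
    (ρ : Matrix (Fin d₀ × Fin n) (Fin d₀ × Fin n) ℂ) :
    Matrix (Fin d₁ × Fin n) (Fin d₁ × Fin n) ℂ :=
  Matrix.of fun p q => ∑ m : Fin d₀, ∑ m' : Fin d₀,
    ρ (m, p.2) (m', q.2) * C (p.1, m) (q.1, m')

/-- The set of achievable worst-case error probabilities in single-use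
discrimination of the channels with Choi matrices `C₁` and `C₂`. -/
noncomputable def discErrors {d₀ d₁ : ℕ}
    (C₁ C₂ : Matrix (Fin d₁ × Fin d₀) (Fin d₁ × Fin d₀) ℂ) : Set ℝ :=
  { x | ∃ n : ℕ, 0 < n ∧
      ∃ ρ : Matrix (Fin d₀ × Fin n) (Fin d₀ × Fin n) ℂ,
        ρ.PosSemidef ∧ ρ.trace = 1 ∧
        ∃ P₁ P₂ : Matrix (Fin d₁ × Fin n) (Fin d₁ × Fin n) ℂ,
          P₁.PosSemidef ∧ P₂.PosSemidef ∧ P₁ + P₂ = 1 ∧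
          x = max ((applyTens C₁ ρ * P₂).trace.re)
                  ((applyTens C₂ ρ * P₁).trace.re) }


open scoped Kronecker

/-- entrywise pairing of two matrices -/
noncomputable def pairing {ι : Type*} [Fintype ι] (C T : Matrix ι ι ℂ) : ℂ :=
  ∑ x, ∑ y, C x y * T x y

lemma contract_psd {P S : Type*} [Fintype P] [Fintype S] [DecidableEq S]
    (M : Matrix (P × S) (P × S) ℂ) (hM : M.PosSemidef) :
    (Matrix.of fun s s' : S => ∑ p : P, ∑ p' : P, M (p, s) (p', s')).PosSemidef := by
  have h := hM.conjTranspose_mul_mul_same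
    (Matrix.of fun (x : P × S) (s : S) => if x.2 = s then (1 : ℂ) else 0)
  convert h using 1
  ext s s'
  simp only [Matrix.mul_apply, Matrix.of_apply, Matrix.conjTranspose_apply,
    Fintype.sum_prod_type, apply_ite star, star_one, star_zero, ite_mul, one_mul, zero_mul,
    mul_ite, mul_one, mul_zero, Finset.sum_ite_eq', Finset.mem_univ, if_true]
  rw [Finset.sum_comm]

lemma pairing_nonneg {ι : Type*} [Fintype ι] [DecidableEq ι] {C T : Matrix ι ι ℂ}
    (hC : C.PosSemidef) (hT : T.PosSemidef) : 0 ≤ pairing C T := by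
  have h := contract_psd (P := ι) (S := Unit) _
    ((hC.kronecker hT).submatrix (fun x : ι × Unit => (x.1, x.1)))
  have := h.diag_nonneg (i := ())
  simpa [pairing] using this

lemma pairing_add {ι : Type*} [Fintype ι] (C S T : Matrix ι ι ℂ) :
    pairing C (S + T) = pairing C S + pairing C T := by
  simp [pairing, mul_add, Finset.sum_add_distrib]

lemma pairing_smul {ι : Type*} [Fintype ι] (c : ℂ) (C T : Matrix ι ι ℂ) :
    pairing C (c • T) = c * pairing C T := by
  simp [pairing, Finset.mul_sum, mul_left_comm]

lemma pairing_one {d₀ d₁ : ℕ} {C : Matrix (Fin d₁ × Fin d₀) (Fin d₁ × Fin d₀) ℂ}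
    (h : ptrFst C = 1) (σ : Matrix (Fin d₀) (Fin d₀) ℂ) :
    pairing C ((1 : Matrix (Fin d₁) (Fin d₁) ℂ) ⊗ₖ σ) = σ.trace := by
  have h' : ∀ b b', ∑ x, C (x, b) (x, b') = (1 : Matrix (Fin d₀) (Fin d₀) ℂ) b b' := by
    intro b b'
    rw [← h]; rfl
  calc pairing C ((1 : Matrix (Fin d₁) (Fin d₁) ℂ) ⊗ₖ σ)
      = ∑ o : Fin d₁, ∑ a, ∑ a', C (o, a) (o, a') * σ a a' := by
        simp only [pairing, Fintype.sum_prod_type, Matrix.kroneckerMap_apply, Matrix.one_apply,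
          ite_mul, one_mul, zero_mul, mul_ite, mul_zero]
        refine Finset.sum_congr rfl fun o _ => Finset.sum_congr rfl fun a _ => ?_
        rw [Finset.sum_comm]
        simp
    _ = ∑ a, ∑ a', (∑ o : Fin d₁, C (o, a) (o, a')) * σ a a' := by
        rw [Finset.sum_comm]
        refine Finset.sum_congr rfl fun a _ => ?_
        rw [Finset.sum_comm]
        simp [Finset.sum_mul]
    _ = σ.trace := by
        simp [h', Matrix.one_apply, Matrix.trace]

/-- one-slot testers -/
def IsTester {d₀ d₁ : ℕ} (T₁ T₂ : Matrix (Fin d₁ × Fin d₀) (Fin d₁ × Fin d₀) ℂ)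
    (σ : Matrix (Fin d₀) (Fin d₀) ℂ) : Prop :=
  T₁.PosSemidef ∧ T₂.PosSemidef ∧ σ.trace = 1 ∧
    T₁ + T₂ = (1 : Matrix (Fin d₁) (Fin d₁) ℂ) ⊗ₖ σ

/-- the tester element of a state and an effect -/
noncomputable def toT {d₀ d₁ n : ℕ} (ρ : Matrix (Fin d₀ × Fin n) (Fin d₀ × Fin n) ℂ)
    (P : Matrix (Fin d₁ × Fin n) (Fin d₁ × Fin n) ℂ) :
    Matrix (Fin d₁ × Fin d₀) (Fin d₁ × Fin d₀) ℂ :=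
  Matrix.of fun x y => ∑ r, ∑ s, ρ (x.2, r) (y.2, s) * P (y.1, s) (x.1, r)

lemma toT_psd {d₀ d₁ n : ℕ} {ρ : Matrix (Fin d₀ × Fin n) (Fin d₀ × Fin n) ℂ}
    {P : Matrix (Fin d₁ × Fin n) (Fin d₁ × Fin n) ℂ} (hρ : ρ.PosSemidef) (hP : P.PosSemidef) :
    (toT ρ P).PosSemidef := by
  have h := contract_psd (P := Fin n) (S := Fin d₁ × Fin d₀) _
    ((hρ.kronecker hP.transpose).submatrix
      (fun x : Fin n × (Fin d₁ × Fin d₀) => ((x.2.2, x.1), (x.2.1, x.1))))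
  simp only [Matrix.submatrix_apply, Matrix.kroneckerMap_apply, Matrix.transpose_apply] at h
  exact h

lemma trace_toT {d₀ d₁ n : ℕ} (C : Matrix (Fin d₁ × Fin d₀) (Fin d₁ × Fin d₀) ℂ)
    (ρ : Matrix (Fin d₀ × Fin n) (Fin d₀ × Fin n) ℂ)
    (P : Matrix (Fin d₁ × Fin n) (Fin d₁ × Fin n) ℂ) :
    (applyTens C ρ * P).trace = pairing C (toT ρ P) := by
  have e1 : (applyTens C ρ * P).trace = ∑ i, ∑ r, ∑ j, ∑ s, ∑ m, ∑ m',
      ρ (m, r) (m', s) * C (i, m) (j, m') * P (j, s) (i, r) := by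
    simp only [Matrix.trace, Matrix.diag, Matrix.mul_apply, applyTens, Matrix.of_apply,
      Fintype.sum_prod_type, Finset.sum_mul]
  have e2 : pairing C (toT ρ P) = ∑ i, ∑ m, ∑ j, ∑ m', ∑ r, ∑ s,
      ρ (m, r) (m', s) * C (i, m) (j, m') * P (j, s) (i, r) := by
    simp only [pairing, toT, Matrix.of_apply, Fintype.sum_prod_type, Finset.mul_sum]
    simp only [mul_assoc, mul_left_comm]
  rw [e1, e2]
  refine Finset.sum_congr rfl fun i _ => ?_
  calc _ = ∑ j, ∑ r, ∑ s, ∑ m, ∑ m',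
          ρ (m, r) (m', s) * C (i, m) (j, m') * P (j, s) (i, r) := Finset.sum_comm
    _ = ∑ j, ∑ m, ∑ m', ∑ r, ∑ s,
          ρ (m, r) (m', s) * C (i, m) (j, m') * P (j, s) (i, r) := by
        refine Finset.sum_congr rfl fun j _ => ?_
        simp only [← Fintype.sum_prod_type']
        exact Finset.sum_bij' (fun x _ => (x.2.2.1, x.2.2.2, x.1, x.2.1))
          (fun x _ => (x.2.2.1, x.2.2.2, x.1, x.2.1))
          (by simp) (by simp) (by simp) (by simp) (by simp)
    _ = _ := Finset.sum_comm

lemma tester_of_mem {d₀ d₁ : ℕ} (C₁ C₂ : Matrix (Fin d₁ × Fin d₀) (Fin d₁ × Fin d₀) ℂ) {x : ℝ}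
    (hx : x ∈ discErrors C₁ C₂) : ∃ T₁ T₂ σ, IsTester T₁ T₂ σ ∧
      x = max (pairing C₁ T₂).re (pairing C₂ T₁).re := by
  obtain ⟨n, -, ρ, hρ, htr, P₁, P₂, h1, h2, hs, rfl⟩ := hx
  refine ⟨toT ρ P₁, toT ρ P₂, Matrix.of fun m m' => ∑ r, ρ (m, r) (m', r),
    ⟨toT_psd hρ h1, toT_psd hρ h2, ?_, ?_⟩, ?_⟩
  · rw [← htr]
    simp [Matrix.trace, Fintype.sum_prod_type]
  · ext x y
    have : ∀ r s, P₁ (y.1, s) (x.1, r) + P₂ (y.1, s) (x.1, r)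
        = if x.1 = y.1 then (if r = s then 1 else 0) else 0 := by
      intro r s
      rw [← Matrix.add_apply, hs, Matrix.one_apply]
      simp only [Prod.mk.injEq]
      split_ifs <;> simp_all
    simp only [toT, Matrix.add_apply, Matrix.of_apply, ← Finset.sum_add_distrib, ← mul_add, this,
      Matrix.kroneckerMap_apply, Matrix.one_apply]
    by_cases h : x.1 = y.1 <;> simp [h]
  · rw [trace_toT, trace_toT]

lemma mem_of_tester {d₀ d₁ : ℕ} (C₁ C₂ : Matrix (Fin d₁ × Fin d₀) (Fin d₁ × Fin d₀) ℂ)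
    (hd : 0 < d₀) {T₁ T₂ σ} (hT : IsTester T₁ T₂ σ) (hσ : σ.PosDef) :
    max (pairing C₁ T₂).re (pairing C₂ T₁).re ∈ discErrors C₁ C₂ := by
  obtain ⟨hT1, hT2, htr, hsum⟩ := hT
  open scoped MatrixOrder in
  obtain ⟨A, hA, hAσ⟩ : ∃ A : Matrix (Fin d₀) (Fin d₀) ℂ, IsUnit A ∧ σ = A * Aᴴ := by
    obtain ⟨B, hB⟩ := CStarAlgebra.nonneg_iff_eq_star_mul_self.1
      (Matrix.nonneg_iff_posSemidef.2 hσ.posSemidef)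
    refine ⟨Bᴴ, ?_, by rw [Matrix.conjTranspose_conjTranspose]; exact hB⟩
    have hu := hσ.isUnit
    rw [hB, Matrix.isUnit_iff_isUnit_det, Matrix.det_mul] at hu
    rw [Matrix.isUnit_iff_isUnit_det]
    exact isUnit_of_mul_isUnit_left hu
  have hdet : IsUnit A.det := (Matrix.isUnit_iff_isUnit_det A).1 hA
  have hAi : A * A⁻¹ = 1 := Matrix.mul_nonsing_inv A hdet
  have hiA : A⁻¹ * A = 1 := Matrix.nonsing_inv_mul A hdet
  let I1 : Matrix (Fin d₁) (Fin d₁) ℂ := 1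
  let Q : Matrix (Fin d₁ × Fin d₀) (Fin d₁ × Fin d₀) ℂ →
      Matrix (Fin d₁ × Fin d₀) (Fin d₁ × Fin d₀) ℂ :=
    fun T => (I1 ⊗ₖ A⁻¹) * T * (I1 ⊗ₖ A⁻¹)ᴴ
  let v : Matrix (Fin d₀ × Fin d₀) Unit ℂ := Matrix.of fun x _ => A x.1 x.2
  have hback : ∀ T, (I1 ⊗ₖ A) * Q T * (I1 ⊗ₖ A)ᴴ = T := by
    intro T
    have h1 : (I1 ⊗ₖ A) * (I1 ⊗ₖ A⁻¹) = 1 := by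
      rw [← Matrix.mul_kronecker_mul, hAi]; simp [I1]
    have h2 : (I1 ⊗ₖ A⁻¹)ᴴ * (I1 ⊗ₖ A)ᴴ = 1 := by
      rw [← Matrix.conjTranspose_mul, h1]; simp
    calc _ = ((I1 ⊗ₖ A) * (I1 ⊗ₖ A⁻¹)) * T * ((I1 ⊗ₖ A⁻¹)ᴴ * (I1 ⊗ₖ A)ᴴ) := by
          simp only [Q, Matrix.mul_assoc]
      _ = T := by rw [h1, h2]; simp
  have hto : ∀ T, toT (v * vᴴ) (Q T)ᵀ = T := by
    intro T
    conv_rhs => rw [← hback T]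
    ext x y
    generalize Q T = q
    simp only [toT, v, I1, Matrix.of_apply, Matrix.mul_apply, Matrix.transpose_apply,
      Matrix.conjTranspose_apply, Matrix.kroneckerMap_apply, Fintype.sum_prod_type,
      Matrix.one_apply, Finset.univ_unique, Finset.sum_singleton]
    symm
    rw [Finset.sum_eq_single y.1 (by intro o _ ho; simp [ho.symm]) (by simp)]
    rw [Finset.sum_comm]
    refine Finset.sum_congr rfl fun s _ => ?_
    rw [Finset.sum_eq_single x.1 (by intro o _ ho; simp [ho.symm]) (by simp)]
    simp only [if_true, one_mul, Finset.sum_mul]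
    refine Finset.sum_congr rfl fun r _ => ?_
    ring
  refine ⟨d₀, hd, v * vᴴ, Matrix.posSemidef_self_mul_conjTranspose v, ?_, (Q T₁)ᵀ, (Q T₂)ᵀ,
    (hT1.mul_mul_conjTranspose_same _).transpose, (hT2.mul_mul_conjTranspose_same _).transpose,
    ?_, ?_⟩
  · rw [← htr, hAσ]
    simp [Matrix.trace, Matrix.mul_apply, v, Fintype.sum_prod_type]
  · rw [← Matrix.transpose_add, ← Matrix.transpose_one]
    congr 1
    simp only [Q]
    rw [← Matrix.add_mul, ← Matrix.mul_add, hsum, hAσ]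
    rw [Matrix.conjTranspose_kronecker, ← Matrix.mul_kronecker_mul, ← Matrix.mul_kronecker_mul]
    have : A⁻¹ * (A * Aᴴ) * (A⁻¹)ᴴ = 1 := by
      rw [← Matrix.mul_assoc, hiA, Matrix.one_mul, ← Matrix.conjTranspose_mul, hiA]; simp
    rw [this]; simp [I1]
  · rw [trace_toT, trace_toT, hto, hto]

/-- pulling back a product tester through the comb -/
noncomputable def pull {d₀ d₁ : ℕ}
    (R : Matrix (Fin d₁ × Fin d₁ × Fin d₁ × Fin d₀ × Fin d₀ × Fin d₀)
      (Fin d₁ × Fin d₁ × Fin d₁ × Fin d₀ × Fin d₀ × Fin d₀) ℂ)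
    (X Y : Matrix (Fin d₁ × Fin d₀) (Fin d₁ × Fin d₀) ℂ) :
    Matrix (Fin d₁ × Fin d₀) (Fin d₁ × Fin d₀) ℂ :=
  Matrix.of fun s s' => ∑ p : (Fin d₁ × Fin d₀) × (Fin d₁ × Fin d₀),
    ∑ p' : (Fin d₁ × Fin d₀) × (Fin d₁ × Fin d₀),
      R (p.1.1, p.2.1, s.1, s.2, p.1.2, p.2.2) (p'.1.1, p'.2.1, s'.1, s'.2, p'.1.2, p'.2.2) *
        (X p.1 p'.1 * Y p.2 p'.2)

section
variable {d₀ d₁ : ℕ}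
    {R : Matrix (Fin d₁ × Fin d₁ × Fin d₁ × Fin d₀ × Fin d₀ × Fin d₀)
      (Fin d₁ × Fin d₁ × Fin d₁ × Fin d₀ × Fin d₀ × Fin d₀) ℂ}

lemma pull_psd (hR : R.PosSemidef) {X Y : Matrix (Fin d₁ × Fin d₀) (Fin d₁ × Fin d₀) ℂ}
    (hX : X.PosSemidef) (hY : Y.PosSemidef) : (pull R X Y).PosSemidef := by
  have h := contract_psd (P := (Fin d₁ × Fin d₀) × (Fin d₁ × Fin d₀)) (S := Fin d₁ × Fin d₀) _
    ((hR.kronecker (hX.kronecker hY)).submatrix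
      (fun x : ((Fin d₁ × Fin d₀) × (Fin d₁ × Fin d₀)) × (Fin d₁ × Fin d₀) =>
        ((x.1.1.1, x.1.2.1, x.2.1, x.2.2, x.1.1.2, x.1.2.2), x.1)))
  simp only [Matrix.submatrix_apply, Matrix.kroneckerMap_apply] at h
  exact h

lemma pull_add_left (X X' Y : Matrix (Fin d₁ × Fin d₀) (Fin d₁ × Fin d₀) ℂ) :
    pull R (X + X') Y = pull R X Y + pull R X' Y := by
  ext s s'
  simp only [pull, Matrix.add_apply, Matrix.of_apply, add_mul, mul_add, Finset.sum_add_distrib]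

lemma pull_add_right (X Y Y' : Matrix (Fin d₁ × Fin d₀) (Fin d₁ × Fin d₀) ℂ) :
    pull R X (Y + Y') = pull R X Y + pull R X Y' := by
  ext s s'
  simp only [pull, Matrix.add_apply, Matrix.of_apply, mul_add, Finset.sum_add_distrib]

lemma pairing_pull {C : Matrix (Fin d₁ × Fin d₀) (Fin d₁ × Fin d₀) ℂ}
    (h : ∀ (o₁ o₁' o₂ o₂' : Fin d₁) (a a' b b' : Fin d₀),
        (∑ so : Fin d₁, ∑ si : Fin d₀, ∑ so' : Fin d₁, ∑ si' : Fin d₀,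
            C (so, si) (so', si') *
              R (o₁, o₂, so, si, a, b) (o₁', o₂', so', si', a', b')) =
          C (o₁, a) (o₁', a') * C (o₂, b) (o₂', b'))
    (X Y : Matrix (Fin d₁ × Fin d₀) (Fin d₁ × Fin d₀) ℂ) :
    pairing C (pull R X Y) = pairing C X * pairing C Y := by
  have h' : ∀ p p' : (Fin d₁ × Fin d₀) × (Fin d₁ × Fin d₀),
      (∑ s : Fin d₁ × Fin d₀, ∑ s' : Fin d₁ × Fin d₀, C s s' *
        R (p.1.1, p.2.1, s.1, s.2, p.1.2, p.2.2) (p'.1.1, p'.2.1, s'.1, s'.2, p'.1.2, p'.2.2))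
      = C p.1 p'.1 * C p.2 p'.2 := by
    intro p p'
    simp only [Fintype.sum_prod_type]
    exact h _ _ _ _ _ _ _ _
  calc pairing C (pull R X Y) = ∑ p : (Fin d₁ × Fin d₀) × (Fin d₁ × Fin d₀),
        ∑ p' : (Fin d₁ × Fin d₀) × (Fin d₁ × Fin d₀),
        (∑ s : Fin d₁ × Fin d₀, ∑ s' : Fin d₁ × Fin d₀, C s s' *
        R (p.1.1, p.2.1, s.1, s.2, p.1.2, p.2.2) (p'.1.1, p'.2.1, s'.1, s'.2, p'.1.2, p'.2.2))
        * (X p.1 p'.1 * Y p.2 p'.2) := by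
        simp only [pairing, pull, Matrix.of_apply, Finset.mul_sum, Finset.sum_mul]
        simp only [← Fintype.sum_prod_type']
        exact Finset.sum_bij' (fun x _ => (x.2.2.1, x.2.2.2, x.1, x.2.1))
          (fun x _ => (x.2.2.1, x.2.2.2, x.1, x.2.1))
          (by simp) (by simp) (by simp) (by simp) (by intros; ring)
    _ = ∑ p : (Fin d₁ × Fin d₀) × (Fin d₁ × Fin d₀),
        ∑ p' : (Fin d₁ × Fin d₀) × (Fin d₁ × Fin d₀),
        (C p.1 p'.1 * X p.1 p'.1) * (C p.2 p'.2 * Y p.2 p'.2) := by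
        refine Finset.sum_congr rfl fun p _ => Finset.sum_congr rfl fun p' _ => ?_
        rw [h']; ring
    _ = pairing C X * pairing C Y := by
        simp only [pairing, Finset.sum_mul_sum]
        rw [Fintype.sum_prod_type]
        refine Finset.sum_congr rfl fun p _ => Finset.sum_congr rfl fun p' _ => ?_
        rw [Fintype.sum_prod_type]

lemma pull_one
    {R₁ : Matrix (Fin d₀ × Fin d₀ × Fin d₀) (Fin d₀ × Fin d₀ × Fin d₀) ℂ}
    (hnorm : ∀ (so so' : Fin d₁) (si si' a a' b b' : Fin d₀),
      (∑ o₁ : Fin d₁, ∑ o₂ : Fin d₁,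
          R (o₁, o₂, so, si, a, b) (o₁, o₂, so', si', a', b')) =
        (if so = so' then (1 : ℂ) else 0) * R₁ (si, a, b) (si', a', b'))
    (hnorm₁ : ∀ a a' b b' : Fin d₀,
      (∑ si : Fin d₀, R₁ (si, a, b) (si, a', b')) =
        if a = a' ∧ b = b' then (1 : ℂ) else 0)
    (σ τ : Matrix (Fin d₀) (Fin d₀) ℂ) :
    ∃ ω : Matrix (Fin d₀) (Fin d₀) ℂ, ω.trace = σ.trace * τ.trace ∧
      pull R ((1 : Matrix (Fin d₁) (Fin d₁) ℂ) ⊗ₖ σ) ((1 : Matrix (Fin d₁) (Fin d₁) ℂ) ⊗ₖ τ) =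
        (1 : Matrix (Fin d₁) (Fin d₁) ℂ) ⊗ₖ ω := by
  refine ⟨Matrix.of fun s s' => ∑ a, ∑ a', ∑ b, ∑ b',
    R₁ (s, a, b) (s', a', b') * (σ a a' * τ b b'), ?_, ?_⟩
  · calc _ = ∑ a, ∑ a', ∑ b, ∑ b', (∑ s, R₁ (s, a, b) (s, a', b')) * (σ a a' * τ b b') := by
          simp only [Matrix.trace, Matrix.diag, Matrix.of_apply, Finset.sum_mul]
          rw [Finset.sum_comm]
          refine Finset.sum_congr rfl fun a _ => ?_
          rw [Finset.sum_comm]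
          refine Finset.sum_congr rfl fun a' _ => ?_
          rw [Finset.sum_comm]
          refine Finset.sum_congr rfl fun b _ => ?_
          rw [Finset.sum_comm]
      _ = σ.trace * τ.trace := by
          simp only [hnorm₁, ite_and, ite_mul, one_mul, zero_mul, Matrix.trace, Matrix.diag,
            Finset.sum_mul_sum]
          refine Finset.sum_congr rfl fun a _ => ?_
          rw [Finset.sum_comm]
          refine Finset.sum_congr rfl fun b _ => ?_
          simp
  · ext s s'
    calc _ = ∑ a, ∑ a', ∑ b, ∑ b', (∑ o₁ : Fin d₁, ∑ o₂ : Fin d₁,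
          R (o₁, o₂, s.1, s.2, a, b) (o₁, o₂, s'.1, s'.2, a', b')) * (σ a a' * τ b b') := by
          have e1 : ∀ f : Fin d₀ → Fin d₀ → Fin d₀ → Fin d₀ → Fin d₁ → Fin d₁ → ℂ,
              ∑ a, ∑ a', ∑ b, ∑ b', ∑ o₁, ∑ o₂, f a a' b b' o₁ o₂ =
              ∑ o₁, ∑ a, ∑ o₂, ∑ b, ∑ a', ∑ b', f a a' b b' o₁ o₂ := by
            intro f
            simp only [← Fintype.sum_prod_type']
            exact Finset.sum_bij'
              (fun x _ => (x.2.2.2.2.1, x.1, x.2.2.2.2.2, x.2.2.1, x.2.1, x.2.2.2.1))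
              (fun x _ => (x.2.1, x.2.2.2.2.1, x.2.2.2.1, x.2.2.2.2.2, x.1, x.2.2.1))
              (by simp) (by simp) (by simp) (by simp) (by simp)
          simp only [Finset.sum_mul]
          rw [e1]
          simp only [pull, Matrix.of_apply, Fintype.sum_prod_type, Matrix.kroneckerMap_apply,
            Matrix.one_apply]
          refine Finset.sum_congr rfl fun o₁ _ => Finset.sum_congr rfl fun a _ =>
            Finset.sum_congr rfl fun o₂ _ => Finset.sum_congr rfl fun b _ => ?_
          rw [Finset.sum_eq_single o₁ (by intro o _ ho; simp [ho.symm]) (by simp)]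
          refine Finset.sum_congr rfl fun a' _ => ?_
          rw [Finset.sum_eq_single o₂ (by intro o _ ho; simp [ho.symm]) (by simp)]
          simp
      _ = _ := by
          simp only [hnorm, Matrix.kroneckerMap_apply, Matrix.of_apply, Matrix.one_apply,
            Finset.mul_sum, mul_assoc]
end

lemma tester_le {d₀ d₁ : ℕ} {C₁ C₂ : Matrix (Fin d₁ × Fin d₀) (Fin d₁ × Fin d₀) ℂ}
    (h₁pos : C₁.PosSemidef) (h₁tp : ptrFst C₁ = 1)
    (h₂pos : C₂.PosSemidef) (h₂tp : ptrFst C₂ = 1) (h0 : 0 < d₀) (h1 : 0 < d₁)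
    (hb : BddBelow (discErrors C₁ C₂))
    {T₁ T₂ σ} (hT : IsTester T₁ T₂ σ) :
    sInf (discErrors C₁ C₂) ≤ max (pairing C₁ T₂).re (pairing C₂ T₁).re := by
  have hσ : σ.PosSemidef := by
    have := (hT.1.add hT.2.1).submatrix (fun a : Fin d₀ => ((⟨0, h1⟩ : Fin d₁), a))
    rw [hT.2.2.2] at this
    convert this using 1
    ext a b
    simp
  have h0' : (d₀ : ℂ) ≠ 0 := by exact_mod_cast h0.ne'
  let τ : Matrix (Fin d₀) (Fin d₀) ℂ := ((d₀ : ℂ)⁻¹) • 1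
  have hτ : τ.PosDef := Matrix.PosDef.one.smul (by
      rw [← Complex.ofReal_natCast, ← Complex.ofReal_inv, Complex.zero_lt_real]; positivity)
  have hτt : τ.trace = 1 := by simp [τ, h0']
  let H : Matrix (Fin d₁ × Fin d₀) (Fin d₁ × Fin d₀) ℂ :=
    (2⁻¹ : ℂ) • ((1 : Matrix (Fin d₁) (Fin d₁) ℂ) ⊗ₖ τ)
  have hH : H.PosSemidef := (Matrix.PosSemidef.one.kronecker hτ.posSemidef).smul (by
      rw [← Complex.ofReal_ofNat, ← Complex.ofReal_inv, Complex.zero_le_real]; positivity)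
  have key : ∀ ε : ℝ, 0 < ε → ε < 1 → sInf (discErrors C₁ C₂) ≤
      max ((1 - ε) * (pairing C₁ T₂).re + ε / 2) ((1 - ε) * (pairing C₂ T₁).re + ε / 2) := by
    intro ε he he1
    have p1 : (0 : ℂ) ≤ ((1 - ε : ℝ) : ℂ) := by exact_mod_cast (by linarith : (0:ℝ) ≤ 1 - ε)
    have p2 : (0 : ℂ) < ((ε : ℝ) : ℂ) := by exact_mod_cast he
    have ht : IsTester (((1 - ε : ℝ) : ℂ) • T₁ + (ε : ℂ) • H) (((1 - ε : ℝ) : ℂ) • T₂ + (ε : ℂ) • H)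
        (((1 - ε : ℝ) : ℂ) • σ + (ε : ℂ) • τ) := by
      refine ⟨(hT.1.smul p1).add (hH.smul p2.le), (hT.2.1.smul p1).add (hH.smul p2.le), ?_, ?_⟩
      · rw [Matrix.trace_add, Matrix.trace_smul, Matrix.trace_smul, hT.2.2.1, hτt]
        simp
      · rw [Matrix.kronecker_add, Matrix.kronecker_smul, Matrix.kronecker_smul, ← hT.2.2.2]
        simp only [H]
        module
    have hm := mem_of_tester C₁ C₂ h0 ht (Matrix.PosDef.posSemidef_add (hσ.smul p1) (hτ.smul p2))
    have := csInf_le hb hm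
    simp only [pairing_add, pairing_smul, H, pairing_one h₁tp, pairing_one h₂tp, hτt,
      Complex.add_re, Complex.re_ofReal_mul] at this
    norm_num at this
    rw [div_eq_mul_one_div ε 2]
    exact le_max_iff.2 this
  have hcont : Continuous (fun ε : ℝ =>
      max ((1 - ε) * (pairing C₁ T₂).re + ε / 2) ((1 - ε) * (pairing C₂ T₁).re + ε / 2)) := by
    fun_prop
  have hlim := (hcont.tendsto 0).mono_left (nhdsWithin_le_nhds (s := Set.Ioi 0))
  simp only [sub_zero, one_mul, zero_div, add_zero] at hlim
  refine ge_of_tendsto hlim ?_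
  filter_upwards [Ioo_mem_nhdsGT (show (0:ℝ) < 1 by norm_num)] with ε he
  exact key ε he.1 he.2


/-- No-cloning theorem for quantum channels: if a single quantum comb perfectly
clones both channels (producing `M_k ⊗ M_k` upon insertion of `M_k` in its
slot, for `k = 1, 2`), then the single-use minimum worst-case discrimination
error of the two channels is `0` or `1/2`. -/
theorem no_cloning_channels (d₀ d₁ : ℕ)
    (C₁ C₂ : Matrix (Fin d₁ × Fin d₀) (Fin d₁ × Fin d₀) ℂ)
    (h₁pos : C₁.PosSemidef) (h₁tp : ptrFst C₁ = 1)
    (h₂pos : C₂.PosSemidef) (h₂tp : ptrFst C₂ = 1)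
    -- the cloning comb `R`, on (clone outputs) ⊗ (slot output) ⊗ (slot input)
    -- ⊗ (clone inputs):
    (R : Matrix (Fin d₁ × Fin d₁ × Fin d₁ × Fin d₀ × Fin d₀ × Fin d₀)
      (Fin d₁ × Fin d₁ × Fin d₁ × Fin d₀ × Fin d₀ × Fin d₀) ℂ)
    (hRpos : R.PosSemidef)
    -- two-comb normalization:
    (R₁ : Matrix (Fin d₀ × Fin d₀ × Fin d₀) (Fin d₀ × Fin d₀ × Fin d₀) ℂ)
    (hnorm : ∀ (so so' : Fin d₁) (si si' a a' b b' : Fin d₀),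
      (∑ o₁ : Fin d₁, ∑ o₂ : Fin d₁,
          R (o₁, o₂, so, si, a, b) (o₁, o₂, so', si', a', b')) =
        (if so = so' then (1 : ℂ) else 0) * R₁ (si, a, b) (si', a', b'))
    (hnorm₁ : ∀ a a' b b' : Fin d₀,
      (∑ si : Fin d₀, R₁ (si, a, b) (si, a', b')) =
        if a = a' ∧ b = b' then (1 : ℂ) else 0)
    -- perfect cloning: linking `R` with `C_k` over the slot factors yields the
    -- Choi matrix of `M_k ⊗ M_k`:
    (hclone : ∀ k : Fin 2,
      ∀ (o₁ o₁' o₂ o₂' : Fin d₁) (a a' b b' : Fin d₀),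
        (∑ so : Fin d₁, ∑ si : Fin d₀, ∑ so' : Fin d₁, ∑ si' : Fin d₀,
            (if k = 0 then C₁ else C₂) (so, si) (so', si') *
              R (o₁, o₂, so, si, a, b) (o₁', o₂', so', si', a', b')) =
          (if k = 0 then C₁ else C₂) (o₁, a) (o₁', a') *
            (if k = 0 then C₁ else C₂) (o₂, b) (o₂', b')) :
    sInf (discErrors C₁ C₂) = 0 ∨ sInf (discErrors C₁ C₂) = 1 / 2 := by
  have hc1 := hclone 0
  have hc2 := hclone 1
  simp only [if_true] at hc1
  simp only [one_ne_zero, if_false] at hc2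
  rcases Nat.eq_zero_or_pos d₀ with h0 | h0
  · left
    subst h0
    have : discErrors C₁ C₂ = ∅ := by
      ext x
      simp only [Set.mem_empty_iff_false, iff_false]
      rintro ⟨n, -, ρ, -, htr, -⟩
      simp [Matrix.trace] at htr
    rw [this, Real.sInf_empty]
  have h1 : 0 < d₁ := by
    rcases Nat.eq_zero_or_pos d₁ with h | h
    · subst h
      have := congrFun (congrFun h₁tp ⟨0, h0⟩) ⟨0, h0⟩
      simp [ptrFst] at this
    · exact h
  have hnn : ∀ x ∈ discErrors C₁ C₂, 0 ≤ x := by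
    intro x hx
    obtain ⟨T₁, T₂, σ, hT, rfl⟩ := tester_of_mem C₁ C₂ hx
    exact le_max_of_le_left (Complex.le_def.1 (pairing_nonneg h₁pos hT.2.1)).1
  have hb : BddBelow (discErrors C₁ C₂) := ⟨0, hnn⟩
  have hhalf : (1 / 2 : ℝ) ∈ discErrors C₁ C₂ := by
    have h0' : (d₀ : ℂ) ≠ 0 := by exact_mod_cast h0.ne'
    let τ : Matrix (Fin d₀) (Fin d₀) ℂ := ((d₀ : ℂ)⁻¹) • 1
    have hτ : τ.PosDef := Matrix.PosDef.one.smul (by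
      rw [← Complex.ofReal_natCast, ← Complex.ofReal_inv, Complex.zero_lt_real]; positivity)
    have hτt : τ.trace = 1 := by simp [τ, h0']
    have hH : ((2⁻¹ : ℂ) • ((1 : Matrix (Fin d₁) (Fin d₁) ℂ) ⊗ₖ τ)).PosSemidef :=
      (Matrix.PosSemidef.one.kronecker hτ.posSemidef).smul (by
      rw [← Complex.ofReal_ofNat, ← Complex.ofReal_inv, Complex.zero_le_real]; positivity)
    have hm := mem_of_tester C₁ C₂ h0 (T₁ := (2⁻¹ : ℂ) • ((1 : Matrix (Fin d₁) (Fin d₁) ℂ) ⊗ₖ τ))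
      (T₂ := (2⁻¹ : ℂ) • ((1 : Matrix (Fin d₁) (Fin d₁) ℂ) ⊗ₖ τ)) (σ := τ)
      ⟨hH, hH, hτt, by module⟩ hτ
    rw [pairing_smul, pairing_smul, pairing_one h₁tp, pairing_one h₂tp, hτt] at hm
    norm_num at hm
    simpa using hm
  have hmaj : ∀ x ∈ discErrors C₁ C₂, sInf (discErrors C₁ C₂) ≤ 3 * x ^ 2 - 2 * x ^ 3 := by
    intro x hx
    obtain ⟨T₁, T₂, σ, hT, rfl⟩ := tester_of_mem C₁ C₂ hx
    obtain ⟨q1, q2, qt, qs⟩ := hT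
    obtain ⟨ω, hω, hω'⟩ := pull_one hnorm hnorm₁ σ σ
    obtain ⟨ω₂, hω₂, hω₂'⟩ := pull_one hnorm hnorm₁ ω σ
    have ht : IsTester
        (pull R (pull R T₁ T₁) T₁ + pull R (pull R T₁ T₁) T₂ + pull R (pull R T₁ T₂) T₁
          + pull R (pull R T₂ T₁) T₁)
        (pull R (pull R T₂ T₂) T₂ + pull R (pull R T₂ T₂) T₁ + pull R (pull R T₂ T₁) T₂
          + pull R (pull R T₁ T₂) T₂) ω₂ := by
      have ps : ∀ {X Y : Matrix (Fin d₁ × Fin d₀) (Fin d₁ × Fin d₀) ℂ}, X.PosSemidef →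
        Y.PosSemidef → (pull R X Y).PosSemidef := fun hX hY => pull_psd hRpos hX hY
      refine ⟨?_, ?_, ?_, ?_⟩
      · exact (((ps (ps q1 q1) q1).add (ps (ps q1 q1) q2)).add (ps (ps q1 q2) q1)).add
          (ps (ps q2 q1) q1)
      · exact (((ps (ps q2 q2) q2).add (ps (ps q2 q2) q1)).add (ps (ps q2 q1) q2)).add
          (ps (ps q1 q2) q2)
      · rw [hω₂, hω, qt]; simp
      · rw [← hω₂', ← hω', ← qs]
        simp only [pull_add_left, pull_add_right]
        abel
    have hle := tester_le h₁pos h₁tp h₂pos h₂tp h0 h1 hb ht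
    have red : ∀ {C : Matrix (Fin d₁ × Fin d₀) (Fin d₁ × Fin d₀) ℂ}, C.PosSemidef →
        ptrFst C = 1 → ∃ e : ℝ, 0 ≤ e ∧ e ≤ 1 ∧ pairing C T₁ = (1 - e : ℝ) ∧
          pairing C T₂ = e := by
      intro C hC hCt
      have a1 := pairing_nonneg hC q1
      have a2 := pairing_nonneg hC q2
      have a3 := pairing_one hCt σ
      rw [← qs, qt, pairing_add] at a3
      rw [Complex.le_def] at a1 a2
      have a4 := congrArg Complex.re a3
      simp only [Complex.add_re, Complex.one_re, Complex.zero_re, Complex.zero_im] at a1 a2 a4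
      refine ⟨(pairing C T₂).re, a2.1, by linarith, ?_, ?_⟩
      · apply Complex.ext
        · simp only [Complex.ofReal_re]; linarith
        · simp only [Complex.ofReal_im]; exact a1.2.symm
      · apply Complex.ext
        · simp
        · simp only [Complex.ofReal_im]; exact a2.2.symm
    obtain ⟨e, e0, e1, eT1, eT2⟩ := red h₁pos h₁tp
    obtain ⟨f, f0, f1, fT1, fT2⟩ := red h₂pos h₂tp
    simp only [pairing_add, pairing_pull hc1, pairing_pull hc2, eT1, eT2, fT1, fT2] at hle
    simp only [eT2, fT1, Complex.ofReal_re]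
    simp only [← Complex.ofReal_mul, ← Complex.ofReal_add, Complex.ofReal_re] at hle
    have mono : ∀ u w : ℝ, 0 ≤ u → u ≤ w → w ≤ 1 →
        3 * u ^ 2 - 2 * u ^ 3 ≤ 3 * w ^ 2 - 2 * w ^ 3 := by
      intro u w hu huw hw
      nlinarith [mul_nonneg (sub_nonneg.2 huw) (mul_nonneg hu (sub_nonneg.2 (huw.trans hw))),
        mul_nonneg (sub_nonneg.2 huw) (mul_nonneg (hu.trans huw) (sub_nonneg.2 hw)),
        mul_nonneg (sub_nonneg.2 huw) (mul_nonneg hu (sub_nonneg.2 hw)),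
        mul_nonneg (sub_nonneg.2 huw) (mul_nonneg (hu.trans huw) (sub_nonneg.2 (huw.trans hw)))]
    refine hle.trans (max_le ?_ ?_)
    · refine le_trans (le_of_eq ?_) (mono e _ e0 (le_max_left _ _) (max_le e1 (by linarith)))
      ring
    · refine le_trans (le_of_eq ?_)
        (mono (1 - f) _ (by linarith) (le_max_right _ _) (max_le e1 (by linarith)))
      ring
  have hp0 : 0 ≤ sInf (discErrors C₁ C₂) := Real.sInf_nonneg hnn
  have hp1 : sInf (discErrors C₁ C₂) ≤ 1 / 2 := csInf_le hb hhalf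
  have hcl : IsClosed {x : ℝ | sInf (discErrors C₁ C₂) ≤ 3 * x ^ 2 - 2 * x ^ 3} :=
    isClosed_le (by fun_prop) (by fun_prop)
  have hfin : sInf (discErrors C₁ C₂) ≤
      3 * sInf (discErrors C₁ C₂) ^ 2 - 2 * sInf (discErrors C₁ C₂) ^ 3 :=
    hcl.closure_subset_iff.2 hmaj (csInf_mem_closure ⟨_, hhalf⟩ hb)
  generalize sInf (discErrors C₁ C₂) = p at hp0 hp1 hfin ⊢
  by_contra hne
  push Not at hne
  have l0 : 0 < p := lt_of_le_of_ne hp0 (Ne.symm hne.1)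
  have l1 : p < 1 / 2 := lt_of_le_of_ne hp1 hne.2
  have := mul_pos (mul_pos l0 (by linarith : 0 < 1 - p)) (by linarith : 0 < 1 - 2 * p)
  nlinarith
end

section
/- (Orthogonality of program states) Let W : ℂ^{d} ⊗ ℂ^{p} → ℂ^{d} ⊗ ℂ^{a} be an isometry (W† W = I). Let U₁, U₂ be d × d unitary matrices, let σ₁, σ₂ be unit vectors in ℂ^{p} and τ₁, τ₂ unit vectors in ℂ^{a}, and suppose that for k = 1, 2 and every ψ ∈ ℂ^{d} one has W(ψ ⊗ σ_k) = (U_k ψ) ⊗ τ_k. If U₁ is not a complex scalar multiple of U₂, then ⟨σ₁, σ₂⟩ = 0. -/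
open Matrix

/-- Kronecker product of vectors, identifying `ℂ^{m} ⊗ ℂ^{n}` with `ℂ^{m·n}`. -/
def kronVec {m n : Type*} (ψ : m → ℂ) (φ : n → ℂ) : m × n → ℂ :=
  fun x => ψ x.1 * φ x.2

theorem kronVec_inner {m n : Type*} [Fintype m] [Fintype n] (φ ψ : m → ℂ) (σ τ : n → ℂ) :
    star (kronVec φ σ) ⬝ᵥ kronVec ψ τ = (star φ ⬝ᵥ ψ) * (star σ ⬝ᵥ τ) := by
  simp only [dotProduct, kronVec, Fintype.sum_prod_type, Finset.sum_mul_sum, Pi.star_apply,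
    star_mul']
  refine Finset.sum_congr rfl fun i _ => Finset.sum_congr rfl fun j _ => ?_
  ring

/-- Orthogonality of program states: if an isometry `W` programs two unitaries
`U₁, U₂` via pure program states `σ₁, σ₂` (with residual states `τ₁, τ₂`), and
`U₁` is not a complex scalar multiple of `U₂`, then `⟨σ₁, σ₂⟩ = 0`. -/
theorem program_states_orthogonal (d p a : ℕ)
    (W : Matrix (Fin d × Fin a) (Fin d × Fin p) ℂ)
    (hW : Wᴴ * W = 1)
    (U₁ U₂ : Matrix (Fin d) (Fin d) ℂ)
    (hU₁ : U₁ ∈ Matrix.unitaryGroup (Fin d) ℂ)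
    (hU₂ : U₂ ∈ Matrix.unitaryGroup (Fin d) ℂ)
    (σ₁ σ₂ : Fin p → ℂ) (τ₁ τ₂ : Fin a → ℂ)
    (hσ₁ : star σ₁ ⬝ᵥ σ₁ = 1) (hσ₂ : star σ₂ ⬝ᵥ σ₂ = 1)
    (hτ₁ : star τ₁ ⬝ᵥ τ₁ = 1) (hτ₂ : star τ₂ ⬝ᵥ τ₂ = 1)
    (hprog₁ : ∀ ψ : Fin d → ℂ, W.mulVec (kronVec ψ σ₁) = kronVec (U₁.mulVec ψ) τ₁)
    (hprog₂ : ∀ ψ : Fin d → ℂ, W.mulVec (kronVec ψ σ₂) = kronVec (U₂.mulVec ψ) τ₂)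
    (hdist : ¬ ∃ c : ℂ, U₁ = c • U₂) :
    star σ₁ ⬝ᵥ σ₂ = 0 := by
  by_contra hs
  apply hdist
  have key : ∀ φ ψ : Fin d → ℂ, (star φ ⬝ᵥ ψ) * (star σ₁ ⬝ᵥ σ₂)
      = (star (U₁.mulVec φ) ⬝ᵥ U₂.mulVec ψ) * (star τ₁ ⬝ᵥ τ₂) := by
    intro φ ψ
    rw [← kronVec_inner, ← kronVec_inner, ← hprog₁, ← hprog₂, star_mulVec, ← dotProduct_mulVec,
      mulVec_mulVec, hW, one_mulVec]
  have hM : (star σ₁ ⬝ᵥ σ₂) • (1 : Matrix (Fin d) (Fin d) ℂ)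
      = (star τ₁ ⬝ᵥ τ₂) • (U₁ᴴ * U₂) := by
    ext i j
    have h := key (Pi.single i 1) (Pi.single j 1)
    rw [star_mulVec, ← dotProduct_mulVec, mulVec_mulVec] at h
    have e : star (Pi.single i 1 : Fin d → ℂ) = Pi.single i 1 := by
      ext k
      by_cases hk : k = i <;> simp [Pi.single_apply, hk]
    rw [e] at h
    simp only [single_one_dotProduct, mulVec_single_one, Matrix.col_apply] at h
    rw [Matrix.smul_apply, Matrix.smul_apply, smul_eq_mul, smul_eq_mul, mul_comm, mul_comm _ ((U₁ᴴ * U₂) i j), ← h,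
      Matrix.one_apply, Pi.single_apply]
  have hU : U₁ * U₁ᴴ = 1 := Matrix.mem_unitaryGroup_iff.mp hU₁
  have h2 := congrArg (fun M => U₁ * M) hM
  simp only [Matrix.mul_smul, Matrix.mul_one, ← Matrix.mul_assoc, hU, Matrix.one_mul] at h2
  refine ⟨(star σ₁ ⬝ᵥ σ₂)⁻¹ * (star τ₁ ⬝ᵥ τ₂), ?_⟩
  rw [mul_smul, ← h2, smul_smul, inv_mul_cancel₀ hs, one_smul]
end

section
/- (Distance criterion for POVMs) Let d ≥ 1, let (e_i)_{i ∈ Fin d} be an orthonormal basis of ℂ^{d}, and set P_i := |e_i⟩⟨e_i| (a von Neumann measurement). Let (Q_i)_{i ∈ Fin d} be any POVM on ℂ^{d}, i.e. a family of positive semidefinite matrices with Σ_i Q_i = I. Then (1/d) Σ_i Tr[P_i Q_i] = 1 if and only if Q_i = P_i for every i. -/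
open Matrix
open scoped ComplexOrder

/-- Distance criterion for POVMs: a POVM `(Q_i)` on `ℂ^d` has fidelity
`(1/d) Σ_i Tr[P_i Q_i] = 1` with the von Neumann measurement
`P_i = |e_i⟩⟨e_i|` if and only if `Q_i = P_i` for every `i`. -/
theorem povm_distance_criterion (d : ℕ) (hd : 1 ≤ d)
    (e : Fin d → (Fin d → ℂ))
    (he : ∀ i j, star (e i) ⬝ᵥ e j = if i = j then (1 : ℂ) else 0)
    (Q : Fin d → Matrix (Fin d) (Fin d) ℂ)
    (hQpos : ∀ i, (Q i).PosSemidef) (hQsum : ∑ i, Q i = 1) :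
    (1 / (d : ℂ)) * ∑ i, (Matrix.vecMulVec (e i) (star (e i)) * Q i).trace = 1 ↔
      ∀ i, Q i = Matrix.vecMulVec (e i) (star (e i)) := by
  have hd0 : (d : ℂ) ≠ 0 := by
    have : d ≠ 0 := by omega
    exact_mod_cast this
  have htr : ∀ (i : Fin d) (A : Matrix (Fin d) (Fin d) ℂ),
      (Matrix.vecMulVec (e i) (star (e i)) * A).trace = star (e i) ⬝ᵥ (A *ᵥ e i) := by
    intro i A
    rw [Matrix.vecMulVec_mul, Matrix.trace_vecMulVec, dotProduct_comm,
      ← Matrix.dotProduct_mulVec]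
  have hP : ∀ i j, Matrix.vecMulVec (e i) (star (e i)) *ᵥ e j
      = if i = j then e i else 0 := by
    intro i j
    rw [Matrix.vecMulVec_mulVec, he]
    split_ifs <;> simp
  constructor
  · intro h
    have hsum : ∑ i, star (e i) ⬝ᵥ (Q i *ᵥ e i) = (d : ℂ) := by
      simp only [htr] at h
      field_simp at h
      exact h
    have hcol : ∀ j, ∑ i, star (e j) ⬝ᵥ (Q i *ᵥ e j) = 1 := by
      intro j
      rw [← dotProduct_sum, ← Matrix.sum_mulVec, hQsum, Matrix.one_mulVec, he]
      simp
    have hnn : ∀ i j, 0 ≤ star (e j) ⬝ᵥ (Q i *ᵥ e j) := fun i j =>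
      (hQpos i).dotProduct_mulVec_nonneg (e j)
    have hle : ∀ i ∈ Finset.univ, 0 ≤ 1 - star (e i) ⬝ᵥ (Q i *ᵥ e i) := by
      intro i _
      rw [sub_nonneg, ← hcol i]
      exact Finset.single_le_sum (f := fun k => star (e i) ⬝ᵥ (Q k *ᵥ e i))
        (fun k _ => hnn k i) (Finset.mem_univ i)
    have hz : ∑ i, (1 - star (e i) ⬝ᵥ (Q i *ᵥ e i)) = 0 := by
      rw [Finset.sum_sub_distrib, hsum]
      simp
    have hdiag : ∀ i, star (e i) ⬝ᵥ (Q i *ᵥ e i) = 1 := fun i =>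
      (sub_eq_zero.mp ((Finset.sum_eq_zero_iff_of_nonneg hle).mp hz i (Finset.mem_univ i))).symm
    have hoff : ∀ i j, i ≠ j → Q i *ᵥ e j = 0 := by
      intro i j hij
      rw [← (hQpos i).dotProduct_mulVec_zero_iff]
      have h1 := hcol j
      rw [← Finset.add_sum_erase _ _ (Finset.mem_univ j), hdiag j, add_eq_left] at h1
      exact (Finset.sum_eq_zero_iff_of_nonneg (fun k _ => hnn k j)).mp h1 i
        (Finset.mem_erase.mpr ⟨hij, Finset.mem_univ i⟩)
    have hon : ∀ j, Q j *ᵥ e j = e j := by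
      intro j
      have h1 : ∑ i, Q i *ᵥ e j = e j := by
        rw [← Matrix.sum_mulVec, hQsum, Matrix.one_mulVec]
      rwa [Finset.sum_eq_single j (fun i _ hij => hoff i j hij) (by simp)] at h1
    intro i
    have hU : (Matrix.of fun a b => e b a)ᴴ * (Matrix.of fun a b => e b a) = 1 := by
      ext a b
      rw [Matrix.one_apply, ← he a b]
      rfl
    have hU' := mul_eq_one_comm.mp hU
    have key : Q i * (Matrix.of fun a b => e b a)
        = Matrix.vecMulVec (e i) (star (e i)) * (Matrix.of fun a b => e b a) := by
      ext a b
      change (Q i *ᵥ e b) a = (Matrix.vecMulVec (e i) (star (e i)) *ᵥ e b) a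
      rw [hP]
      split_ifs with hib
      · subst hib
        rw [hon]
      · rw [hoff i b hib]
    have := congrArg (· * (Matrix.of fun a b => e b a)ᴴ) key
    simpa only [Matrix.mul_assoc, hU', Matrix.mul_one] using this
  · intro h
    have : ∀ i, (Matrix.vecMulVec (e i) (star (e i)) * Q i).trace = 1 := by
      intro i
      rw [htr, h, hP, if_pos rfl, he, if_pos rfl]
    simp [this, hd0]
end

section
/- (Extremality conditions for constrained families of 2×2 positive matrices) Let L be a finite index set, let (d_ℓ)_{ℓ ∈ L} be strictly positive real numbers, and let c₊, c₋ be real numbers. Let 𝖬 be the convex set of families s : L → Matrix (Fin 2) (Fin 2) ℂ such that each s_ℓ is positive semidefinite and the weighted sum Σ_ℓ d_ℓ s_ℓ has (1,1) entry equal to c₊ and (2,2) entry equal to c₋. If s is an extreme point of 𝖬, then every s_ℓ has rank at most 1, and at most two of the s_ℓ are nonzero. -/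
open Matrix
open scoped ComplexOrder

/-- The convex set of families of positive semidefinite `2×2` matrices whose
weighted sum has prescribed diagonal entries `c₊` (at `(1,1)`) and `c₋`
(at `(2,2)`). -/
def constrainedFamilies {L : Type*} [Fintype L] (d : L → ℝ) (cp cm : ℝ) :
    Set (L → Matrix (Fin 2) (Fin 2) ℂ) :=
  { s | (∀ ℓ, (s ℓ).PosSemidef) ∧
        (∑ ℓ, (d ℓ : ℂ) • s ℓ) 0 0 = (cp : ℂ) ∧
        (∑ ℓ, (d ℓ : ℂ) • s ℓ) 1 1 = (cm : ℂ) }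

lemma psd_two (a c : ℝ) (b : ℂ) (ha : 0 ≤ a) (hc : 0 ≤ c) (hb : Complex.normSq b ≤ a * c) :
    (!![(a : ℂ), b; star b, (c : ℂ)] : Matrix (Fin 2) (Fin 2) ℂ).PosSemidef := by
  refine Matrix.PosSemidef.of_dotProduct_mulVec_nonneg ?_ ?_
  · ext i j
    fin_cases i <;> fin_cases j <;> simp
  · intro x
    rw [Complex.nonneg_iff]
    simp only [dotProduct, Matrix.mulVec, Fin.sum_univ_two]
    simp only [Complex.normSq_apply] at hb
    simp
    generalize (x 0).re = p
    generalize (x 0).im = q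
    generalize (x 1).re = r
    generalize (x 1).im = t
    generalize b.re = u at *
    generalize b.im = v at *
    constructor
    · rcases ha.eq_or_lt with h | h
      · subst h
        have hu : u = 0 := by nlinarith [mul_self_nonneg u, mul_self_nonneg v]
        have hv : v = 0 := by nlinarith [mul_self_nonneg u, mul_self_nonneg v]
        subst hu hv
        nlinarith [mul_nonneg hc (mul_self_nonneg r), mul_nonneg hc (mul_self_nonneg t)]
      · refine (mul_nonneg_iff_of_pos_left h).1 ?_
        nlinarith [mul_self_nonneg (a * p + u * r - v * t), mul_self_nonneg (a * q + u * t + v * r),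
          mul_nonneg (sub_nonneg.2 hb) (add_nonneg (mul_self_nonneg r) (mul_self_nonneg t))]
    · ring

lemma perturb_zero {L : Type*} [Fintype L]
    (d : L → ℝ) (cp cm : ℝ)
    (s z : L → Matrix (Fin 2) (Fin 2) ℂ)
    (hs : s ∈ constrainedFamilies d cp cm)
    (hext : ∀ s' s'', s' ∈ constrainedFamilies d cp cm →
      s'' ∈ constrainedFamilies d cp cm →
      s = (fun ℓ => (2⁻¹ : ℂ) • (s' ℓ + s'' ℓ)) → s' = s ∧ s'' = s)
    (h1 : ∀ ℓ, (s ℓ + z ℓ).PosSemidef) (h2 : ∀ ℓ, (s ℓ - z ℓ).PosSemidef)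
    (h3 : ∑ ℓ, (d ℓ : ℂ) * z ℓ 0 0 = 0) (h4 : ∑ ℓ, (d ℓ : ℂ) * z ℓ 1 1 = 0) : z = 0 := by
  obtain ⟨-, hp, hm⟩ := hs
  have := (hext (s + z) (s - z) ⟨h1, ?_, ?_⟩ ⟨h2, ?_, ?_⟩ ?_).1
  · simpa using this
  · simp [Matrix.sum_apply, mul_add, Finset.sum_add_distrib] at hp ⊢
    rw [hp, h3, add_zero]
  · simp [Matrix.sum_apply, mul_add, Finset.sum_add_distrib] at hm ⊢
    rw [hm, h4, add_zero]
  · simp [Matrix.sum_apply, mul_sub, Finset.sum_sub_distrib] at hp ⊢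
    rw [hp, h3, sub_zero]
  · simp [Matrix.sum_apply, mul_sub, Finset.sum_sub_distrib] at hm ⊢
    rw [hm, h4, sub_zero]
  · ext ℓ i j
    simp
    ring

lemma psd_form (A : Matrix (Fin 2) (Fin 2) ℂ) (h : A.PosSemidef) :
    ∃ (a c : ℝ) (b : ℂ), 0 ≤ a ∧ 0 ≤ c ∧ Complex.normSq b ≤ a * c ∧
      A = !![(a : ℂ), b; star b, (c : ℂ)] := by
  have h0 := h.diag_nonneg (i := 0)
  have h1 := h.diag_nonneg (i := 1)
  have hd := h.det_nonneg
  have hh : star (A 0 1) = A 1 0 := h.1.apply 1 0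
  rw [Complex.nonneg_iff] at h0 h1
  have e0 : A 0 0 = ((A 0 0).re : ℂ) := Complex.ext rfl (by simp [← h0.2])
  have e1 : A 1 1 = ((A 1 1).re : ℂ) := Complex.ext rfl (by simp [← h1.2])
  refine ⟨(A 0 0).re, (A 1 1).re, A 0 1, h0.1, h1.1, ?_, ?_⟩
  · rw [Matrix.det_fin_two, ← hh, e0, e1, Complex.nonneg_iff] at hd
    have := hd.1
    simp at this
    rw [Complex.normSq_apply]
    linarith
  · ext i j
    fin_cases i <;> fin_cases j
    · exact e0
    · rfl
    · exact hh.symm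
    · exact e1

/-- Extremality conditions for constrained families of `2×2` positive
matrices: an extreme point of the constrained set has all members of rank at
most one, and at most two nonzero members. -/
theorem extreme_point_rank_and_support {L : Type*} [Fintype L]
    (d : L → ℝ) (hd : ∀ ℓ, 0 < d ℓ) (cp cm : ℝ)
    (s : L → Matrix (Fin 2) (Fin 2) ℂ)
    (hs : s ∈ constrainedFamilies d cp cm)
    (hext : ∀ s' s'', s' ∈ constrainedFamilies d cp cm →
      s'' ∈ constrainedFamilies d cp cm →
      s = (fun ℓ => (2⁻¹ : ℂ) • (s' ℓ + s'' ℓ)) → s' = s ∧ s'' = s) :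
    (∀ ℓ, (s ℓ).rank ≤ 1) ∧
    (∃ t : Finset L, t.card ≤ 2 ∧ ∀ ℓ, s ℓ ≠ 0 → ℓ ∈ t) := by
  classical
  constructor
  · intro k
    by_contra hr
    obtain ⟨a, c, b, ha, hc, hb, hA⟩ := psd_form _ (hs.1 k)
    have hlt : Complex.normSq b < a * c := by
      refine lt_of_le_of_ne hb fun he => hr ?_
      have hdet : (s k).det = 0 := by
        rw [hA, Matrix.det_fin_two]
        simp [Complex.mul_conj, he]
      have h2 : (s k).rank ≤ 2 := by simpa using (s k).rank_le_card_width
      by_contra h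
      have h3 : (s k).rank = 2 := by omega
      have hu : IsUnit (s k) := by
        have : LinearIndependent ℂ (s k).col := by
          rw [linearIndependent_iff_card_eq_finrank_span]
          rw [Set.finrank, ← Matrix.rank_eq_finrank_span_cols, h3]; simp
        exact Matrix.linearIndependent_cols_iff_isUnit.1 this
      rw [Matrix.isUnit_iff_isUnit_det, hdet] at hu
      simp at hu
    set D := a * c - Complex.normSq b with hD
    have hDpos : 0 < D := by linarith
    set M := 2 * |b.re| + 1 with hM
    have hMpos : 0 < M := by positivity
    obtain ⟨e, he0, he1, he2⟩ : ∃ e : ℝ, 0 < e ∧ e ≤ 1 ∧ e * M ≤ D :=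
      ⟨min 1 (D / M), by positivity, min_le_left _ _,
        (le_div_iff₀ hMpos).1 (min_le_right _ _)⟩
    let Z : Matrix (Fin 2) (Fin 2) ℂ := !![0, (e : ℂ); (e : ℂ), 0]
    have hz := perturb_zero d cp cm s (Pi.single k Z) hs hext ?_ ?_ ?_ ?_
    · have := congrFun (congrFun (congrFun hz k) 0) 1
      simp [Z] at this
      exact he0.ne' this
    · intro ℓ
      by_cases h : ℓ = k
      · subst h
        have := psd_two a c (b + e) ha hc (by
          simp only [Complex.normSq_apply] at *
          simp
          nlinarith [le_abs_self b.re, neg_abs_le b.re])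
        convert this using 1
        rw [hA]
        ext i j; fin_cases i <;> fin_cases j <;> simp [Z]
      · simpa [h] using hs.1 ℓ
    · intro ℓ
      by_cases h : ℓ = k
      · subst h
        have := psd_two a c (b - e) ha hc (by
          simp only [Complex.normSq_apply] at *
          simp
          nlinarith [le_abs_self b.re, neg_abs_le b.re])
        convert this using 1
        rw [hA]
        ext i j; fin_cases i <;> fin_cases j <;> simp [Z]
      · simpa [h] using hs.1 ℓ
    all_goals
      refine Finset.sum_eq_zero fun ℓ _ => ?_
      by_cases h : ℓ = k
      · subst h; simp [Z]
      · simp [h]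
  · refine ⟨Finset.univ.filter (fun ℓ => s ℓ ≠ 0), ?_, by simp⟩
    set t := Finset.univ.filter (fun ℓ => s ℓ ≠ 0) with ht
    by_contra hcard
    choose a c b ha hc hb hA using fun ℓ => psd_form _ (hs.1 ℓ)
    let v : L → ℝ × ℝ := fun ℓ => (d ℓ * a ℓ, d ℓ * c ℓ)
    have hli : ¬ LinearIndepOn ℝ v (t : Set L) := by
      intro h
      have := LinearIndependent.fintype_card_le_finrank h
      simp at this
      exact hcard (by simpa [ht, Fintype.card_subtype] using this)
    rw [not_linearIndepOn_finset_iff] at hli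
    obtain ⟨f, hf, k, hk, hfk⟩ := hli
    have hsub : ∑ ℓ, f ℓ • v ℓ = 0 := by
      rw [← hf]
      symm
      apply Finset.sum_subset (Finset.subset_univ _)
      intro ℓ _ hℓ
      have h0 : s ℓ = 0 := by simpa [ht] using hℓ
      have e0 := congrFun (congrFun ((hA ℓ).symm.trans h0) 0) 0
      have e1 := congrFun (congrFun ((hA ℓ).symm.trans h0) 1) 1
      simp at e0 e1
      simp [v, e0, e1]
    have hs1 := congrArg Prod.fst hsub
    have hs2 := congrArg Prod.snd hsub
    simp only [Prod.fst_sum, Prod.snd_sum, v, Prod.smul_mk, smul_eq_mul, Prod.fst_zero,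
      Prod.snd_zero] at hs1 hs2
    set S := ∑ ℓ, |f ℓ| + 1 with hS
    have hSpos : 0 < S := by
      have : 0 ≤ ∑ ℓ, |f ℓ| := Finset.sum_nonneg fun _ _ => abs_nonneg _
      linarith
    have hfS : ∀ ℓ, |f ℓ / S| ≤ 1 := by
      intro ℓ
      rw [abs_div, abs_of_pos hSpos, div_le_one hSpos]
      have := Finset.single_le_sum (f := fun ℓ => |f ℓ|) (fun i _ => abs_nonneg _)
        (Finset.mem_univ ℓ)
      linarith
    have hz := perturb_zero d cp cm s (fun ℓ => (f ℓ / S) • s ℓ) hs hext ?_ ?_ ?_ ?_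
    · have h := congrFun hz k
      simp only [Pi.zero_apply, smul_eq_zero, div_eq_zero_iff] at h
      have hk' : s k ≠ 0 := by simpa [ht] using hk
      rcases h with (h | h) | h
      · exact hfk h
      · exact hSpos.ne' h
      · exact hk' h
    · intro ℓ
      have : s ℓ + (f ℓ / S) • s ℓ = (1 + f ℓ / S) • s ℓ := by rw [add_smul, one_smul]
      rw [this]
      exact (hs.1 ℓ).smul (by linarith [(abs_le.1 (hfS ℓ)).1])
    · intro ℓ
      have : s ℓ - (f ℓ / S) • s ℓ = (1 - f ℓ / S) • s ℓ := by rw [sub_smul, one_smul]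
      rw [this]
      exact (hs.1 ℓ).smul (by linarith [(abs_le.1 (hfS ℓ)).2])
    · have : ∀ ℓ, (d ℓ : ℂ) * ((f ℓ / S) • s ℓ) 0 0 = (((f ℓ * (d ℓ * a ℓ)) / S : ℝ) : ℂ) := by
        intro ℓ
        rw [Matrix.smul_apply, hA ℓ]
        simp
        ring
      simp only [this]
      rw [← Complex.ofReal_sum, ← Finset.sum_div, hs1]
      simp
    · have : ∀ ℓ, (d ℓ : ℂ) * ((f ℓ / S) • s ℓ) 1 1 = (((f ℓ * (d ℓ * c ℓ)) / S : ℝ) : ℂ) := by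
        intro ℓ
        rw [Matrix.smul_apply, hA ℓ]
        simp
        ring
      simp only [this]
      rw [← Complex.ofReal_sum, ← Finset.sum_div, hs2]
      simp
end
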